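/- Let (q_n) be a sequence of positive integers with Σ_{n≥1} q_n/q_{n+1} < ∞. Then for (λ × λ)-almost every pair (x, y) ∈ 𝕋 × 𝕋, there exist infinitely many n with m_n(x) = m_n(y). -/

import Mathlib

open MeasureTheory Filter

/-- The Haar function `T : 𝕋 → ℤ`, equal to `1` on `[0,1/2)` and `-1` on `[1/2,1)`. -/
noncomputable def haarT (x : UnitAddCircle) : ℤ :=
  if (AddCircle.equivIco 1 0 x : ℝ) < 1/2 then 1 else -1

/-- `m_n(x) = T(q_1 x) + ⋯ + T(q_n x)` (here `q j`, `j < n`, stands for the paper's `q_{j+1}`). -/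
noncomputable def mSum (q : ℕ → ℕ) (n : ℕ) (x : UnitAddCircle) : ℤ :=
  ∑ j ∈ Finset.range n, haarT (q j • x)

instance : IsProbabilityMeasure (volume : Measure UnitAddCircle) :=
  ⟨UnitAddCircle.measure_univ⟩

lemma abs_haarT (x : UnitAddCircle) : |haarT x| = 1 := by
  unfold haarT; split_ifs <;> simp

lemma haarT_coe (r : ℝ) :
    haarT (r : UnitAddCircle) = if Int.fract r < 1 / 2 then 1 else -1 := by
  have h := AddCircle.coe_equivIco_mk_apply (p := (1 : ℝ)) r
  rw [div_one, mul_one] at h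
  simp only [haarT]
  rw [← h]

lemma measurable_haarT : Measurable haarT :=
  Measurable.ite (measurableSet_lt
    (measurable_subtype_coe.comp (AddCircle.measurableEquivIco 1 0).measurable) measurable_const)
    measurable_const measurable_const

lemma haarT_add_half (u : UnitAddCircle) : haarT (u + ((1 / 2 : ℝ) : UnitAddCircle)) = -haarT u := by
  induction u using QuotientAddGroup.induction_on with
  | H r =>
    change haarT ((r : UnitAddCircle) + _) = -haarT (r : UnitAddCircle)
    rw [← AddCircle.coe_add, haarT_coe, haarT_coe]
    have h0 := Int.fract_nonneg r
    have h1 := Int.fract_lt_one r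
    by_cases h : Int.fract r < 1 / 2
    · have : Int.fract (r + 1 / 2) = Int.fract r + 1 / 2 := by
        rw [Int.fract_eq_iff]
        exact ⟨by linarith, by linarith, ⌊r⌋, by linarith [Int.self_sub_floor r]⟩
      rw [this, if_neg (by linarith), if_pos h]
    · have : Int.fract (r + 1 / 2) = Int.fract r - 1 / 2 := by
        rw [Int.fract_eq_iff]
        exact ⟨by linarith, by linarith, ⌊r⌋ + 1, by push_cast; linarith [Int.self_sub_floor r]⟩
      rw [this, if_pos (by linarith), if_neg h, neg_neg]

/-- A translation by `t` changes the value of the Haar function on a set of measure at most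
`2 * t`. -/
lemma volume_haarT_ne_add_le {t : ℝ} (ht : 0 ≤ t) :
    volume {u : UnitAddCircle | haarT u ≠ haarT (u + (t : UnitAddCircle))} ≤
      ENNReal.ofReal (2 * t) := by
  rcases le_or_gt (1 / 2) t with h | h
  · calc _ ≤ (1 : ENNReal) := prob_le_one
      _ ≤ _ := by rw [ENNReal.one_le_ofReal]; linarith
  have hsub : {u : UnitAddCircle | haarT u ≠ haarT (u + (t : UnitAddCircle))} ⊆
      Metric.closedBall ((1 / 2 - t / 2 : ℝ) : UnitAddCircle) (t / 2) ∪
        Metric.closedBall ((1 - t / 2 : ℝ) : UnitAddCircle) (t / 2) := by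
    intro u hu
    obtain ⟨r, hr, rfl⟩ := (AddCircle.coe_image_Ico_eq (1 : ℝ) 0).ge (Set.mem_univ u)
    rw [zero_add] at hr
    have hfr : Int.fract r = r := Int.fract_eq_self.2 hr
    have key : |r - (1 / 2 - t / 2)| ≤ t / 2 ∨ |r - (1 - t / 2)| ≤ t / 2 := by
      by_contra! hc
      apply hu
      rw [← AddCircle.coe_add, haarT_coe, haarT_coe, hfr]
      obtain ⟨hr0, hr1⟩ := hr
      rw [lt_abs, lt_abs] at hc
      rcases lt_or_ge (r + t) 1 with h1 | h1
      · rw [Int.fract_eq_self.2 ⟨by linarith, h1⟩]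
        refine if_congr ?_ rfl rfl
        constructor <;> intro h2 <;> rcases hc with ⟨h3 | h3, h4 | h4⟩ <;> linarith
      · rcases hc with ⟨h3 | h3, h4 | h4⟩ <;> linarith
    have hdist (a : ℝ) (ha : |r - a| ≤ t / 2) :
        (r : UnitAddCircle) ∈ Metric.closedBall (a : UnitAddCircle) (t / 2) := by
      rw [Metric.mem_closedBall, dist_eq_norm, ← AddCircle.coe_sub]
      exact QuotientAddGroup.norm_mk_le_norm.trans ha
    exact key.imp (hdist _) (hdist _)
  calc _ ≤ _ := measure_mono hsub
    _ ≤ _ := measure_union_le _ _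
    _ ≤ ENNReal.ofReal t + ENNReal.ofReal t := by
      gcongr <;> rw [AddCircle.volume_closedBall] <;> gcongr <;>
        exact (min_le_right _ _).trans (by linarith)
    _ = _ := by rw [← ENNReal.ofReal_add ht ht, two_mul]

lemma volume_haarT_nsmul_ne_add_le {k : ℕ} (hk : 0 < k) {s : ℝ} (hs : 0 ≤ s) :
    volume {u : UnitAddCircle | haarT (k • u) ≠ haarT (k • (u + (s : UnitAddCircle)))} ≤
      ENNReal.ofReal (2 * (k * s)) := by
  have hmp : MeasurePreserving (fun u : UnitAddCircle => k • u) volume volume := by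
    simpa using Measure.measurePreserving_zsmul (volume : Measure UnitAddCircle)
      (n := (k : ℤ)) (by omega)
  have hmeas : MeasurableSet {u : UnitAddCircle |
      haarT u ≠ haarT (u + ((k * s : ℝ) : UnitAddCircle))} :=
    (measurableSet_eq_fun measurable_haarT
      (measurable_haarT.comp (measurable_add_const _))).compl
  refine le_of_eq_of_le ?_ (volume_haarT_ne_add_le (mul_nonneg k.cast_nonneg hs))
  rw [← hmp.measure_preimage hmeas.nullMeasurableSet]
  congr 1
  ext u
  simp only [Set.mem_ofPred_eq, Set.mem_preimage, smul_add]
  rw [← AddCircle.coe_nsmul, nsmul_eq_mul]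

/-- If the ratios `q n / q (n + 1)` are summable, so are the sums `∑ j < n, q j / q n`. -/
lemma summable_sum_div {q : ℕ → ℝ} (hq : ∀ n, 0 < q n)
    (hsum : Summable fun n => q n / q (n + 1)) :
    Summable fun n => ∑ j ∈ Finset.range n, q j / q n := by
  set a : ℕ → ℝ := fun n => q n / q (n + 1) with ha
  set b : ℕ → ℝ := fun n => ∑ j ∈ Finset.range n, q j / q n with hb
  have ha0 (n) : 0 ≤ a n := (div_pos (hq _) (hq _)).le
  have hb0 (n) : 0 ≤ b n := Finset.sum_nonneg fun j _ => (div_pos (hq _) (hq _)).le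
  have hrec (n) : b (n + 1) = (1 + b n) * a n := by
    simp only [hb, ha]
    rw [Finset.sum_range_succ, add_mul, one_mul, add_comm, Finset.sum_mul]
    congr 1
    refine Finset.sum_congr rfl fun j _ => ?_
    have := (hq n).ne'
    field_simp
  have hexp (n) : 1 + b n ≤ Real.exp (∑ i ∈ Finset.range n, a i) := by
    induction n with
    | zero => simp [hb]
    | succ n ih =>
      rw [Finset.sum_range_succ, Real.exp_add, hrec]
      calc 1 + (1 + b n) * a n ≤ (1 + b n) * (a n + 1) := by linarith [hb0 n]
        _ ≤ _ := mul_le_mul ih (Real.add_one_le_exp _) (by linarith [ha0 n]) (Real.exp_pos _).le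
  rw [← summable_nat_add_iff 1]
  refine Summable.of_nonneg_of_le (fun n => hb0 _) (fun n => ?_)
    (hsum.mul_left (Real.exp (∑' i, a i)))
  rw [hrec]
  refine mul_le_mul_of_nonneg_right ((hexp n).trans ?_) (ha0 n)
  exact Real.exp_le_exp.2 (hsum.sum_le_tsum _ fun i _ => ha0 i)

/-- A bounded process whose conditional drifts are summable in `L¹` has partial sums which converge
almost surely wherever they are bounded below. -/
lemma ae_tendsto_sum_of_bddBelow {Ω : Type*} {m0 : MeasurableSpace Ω} {μ : Measure Ω}
    [IsProbabilityMeasure μ] {ℱ : Filtration ℕ m0} {X : ℕ → Ω → ℝ}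
    (hX : ∀ n, StronglyMeasurable[ℱ (n + 1)] (X n)) (hbdd : ∀ n ω, |X n ω| ≤ 1)
    (hsum : Summable fun n => ∫ ω, |(μ[X n | ℱ n]) ω| ∂μ) :
    ∀ᵐ ω ∂μ, BddBelow (Set.range fun n => ∑ i ∈ Finset.range n, X i ω) →
      ∃ c, Tendsto (fun n => ∑ i ∈ Finset.range n, X i ω) atTop (nhds c) := by
  have hint (n) : Integrable (X n) μ :=
    Integrable.of_bound ((hX n).mono (ℱ.le _)).aestronglyMeasurable 1
      (Eventually.of_forall fun ω => hbdd n ω)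
  set S : ℕ → Ω → ℝ := fun n => ∑ i ∈ Finset.range n, X i with hS
  have hSd (n) : S (n + 1) - S n = X n := by simp [hS, Finset.sum_range_succ]
  have hSad : StronglyAdapted ℱ S := fun n =>
    Finset.stronglyMeasurable_sum _ fun i hi => (hX i).mono (ℱ.mono (Finset.mem_range.1 hi))
  have hSint (n) : Integrable (S n) μ := integrable_finsetSum' _ fun i _ => hint i
  have hM := martingale_martingalePart (μ := μ) hSad hSint
  have hMb : ∀ᵐ ω ∂μ, ∀ i,
      |martingalePart S ℱ μ (i + 1) ω - martingalePart S ℱ μ i ω| ≤ ((2 : NNReal) : ℝ) := by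
    have := martingalePart_bdd_difference (μ := μ) (R := 1) (f := S) ℱ
      (Eventually.of_forall fun ω i => by
        rw [← Pi.sub_apply, hSd]; exact hbdd i ω)
    simpa using this
  have hA : ∀ᵐ ω ∂μ, Summable fun n => (μ[X n | ℱ n]) ω := by
    have hfin : ∫⁻ ω, ∑' n, ‖(μ[X n | ℱ n]) ω‖ₑ ∂μ ≠ ⊤ := by
      rw [lintegral_tsum fun n => integrable_condExp.aestronglyMeasurable.enorm]
      simp_rw [← ofReal_integral_norm_eq_lintegral_enorm integrable_condExp]
      exact hsum.tsum_ofReal_ne_top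
    have hmeas : AEMeasurable (fun ω => ∑' n, ‖(μ[X n | ℱ n]) ω‖ₑ) μ :=
      AEMeasurable.tsum fun n => integrable_condExp.aestronglyMeasurable.enorm
    filter_upwards [ae_lt_top' hmeas hfin] with ω hω
    exact (NNReal.summable_coe.2 (ENNReal.tsum_coe_ne_top_iff_summable.1 hω.ne)).of_norm
  filter_upwards [hM.bddAbove_range_iff_bddBelow_range hMb,
    hM.submartingale.bddAbove_iff_exists_tendsto hMb, hA] with ω h1 h2 h3 h4
  have hP : Tendsto (fun n => predictablePart S ℱ μ n ω) atTop
      (nhds (∑' n, (μ[X n | ℱ n]) ω)) := by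
    simpa [predictablePart, hSd] using h3.hasSum.tendsto_sum_nat
  have hSω (n) : ∑ i ∈ Finset.range n, X i ω = S n ω := by simp [hS]
  simp only [hSω] at h4 ⊢
  have hMeq (n) : martingalePart S ℱ μ n ω = S n ω - predictablePart S ℱ μ n ω := rfl
  have hbelow : BddBelow (Set.range fun n => martingalePart S ℱ μ n ω) := by
    obtain ⟨a, ha⟩ := h4
    obtain ⟨b, hb⟩ := hP.bddAbove_range
    refine ⟨a - b, ?_⟩
    rintro _ ⟨n, rfl⟩
    exact (sub_le_sub (ha ⟨n, rfl⟩) (hb ⟨n, rfl⟩)).trans_eq (hMeq n).symm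
  obtain ⟨c, hc⟩ := h2.1 (h1.2 hbelow)
  refine ⟨_, (hc.add hP).congr fun n => ?_⟩
  rw [hMeq]; ring

/-- If a measure-preserving map negates `X` and preserves all `m`-measurable sets off `E`,
then the conditional expectation of `X` given `m` has `L¹` norm at most `μ E`. -/
lemma integral_abs_condExp_le_of_comp_eq_neg {Ω : Type*} {m m0 : MeasurableSpace Ω}
    {μ : Measure Ω} [IsProbabilityMeasure μ] (hm : m ≤ m0)
    {X : Ω → ℝ} (hX : Measurable X) (hbdd : ∀ ω, |X ω| ≤ 1) {τ : Ω → Ω}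
    (hτ : MeasurePreserving τ μ μ) (hneg : ∀ ω, X (τ ω) = -X ω) {E : Set Ω}
    (hEm : MeasurableSet E) (hE : ∀ A, MeasurableSet[m] A → ∀ ω ∉ E, (ω ∈ A ↔ τ ω ∈ A)) :
    ∫ ω, |(μ[X | m]) ω| ∂μ ≤ μ.real E := by
  classical
  have hXint : Integrable X μ := Integrable.of_bound hX.aestronglyMeasurable 1
    (Eventually.of_forall fun ω => hbdd ω)
  set A : Set Ω := {ω | 0 ≤ (μ[X | m]) ω}
  have hA : MeasurableSet[m] A :=
    measurableSet_le measurable_const stronglyMeasurable_condExp.measurable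
  set φ : Ω → ℝ := fun ω => if ω ∈ A then 1 else -1
  have hφ : Measurable[m] φ := Measurable.ite hA measurable_const measurable_const
  have hφ0 : Measurable φ := hφ.mono hm le_rfl
  have hφb (ω) : ‖φ ω‖ ≤ 1 := by simp only [φ]; split_ifs <;> simp
  have hφX : Integrable (φ * X) μ := hXint.bdd_mul hφ0.aestronglyMeasurable
    (Eventually.of_forall hφb)
  have h1 : ∫ ω, |(μ[X | m]) ω| ∂μ = ∫ ω, φ ω * X ω ∂μ := by
    have hpull := condExp_mul_of_stronglyMeasurable_left hφ.stronglyMeasurable hφX hXint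
    calc _ = ∫ ω, (φ * μ[X | m]) ω ∂μ := by
          congr 1; ext ω
          simp only [Pi.mul_apply, φ]
          split_ifs with h
          · rw [one_mul, abs_of_nonneg h]
          · rw [neg_one_mul, abs_of_neg (not_le.1 h)]
      _ = ∫ ω, (μ[φ * X | m]) ω ∂μ := (integral_congr_ae hpull).symm
      _ = _ := integral_condExp hm
  have h2 : ∫ ω, φ ω * X ω ∂μ = ∫ ω, -(φ (τ ω) * X ω) ∂μ := by
    calc _ = ∫ ω, φ ω * X ω ∂(μ.map τ) := by rw [hτ.map_eq]
      _ = ∫ ω, φ (τ ω) * X (τ ω) ∂μ :=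
        integral_map hτ.aemeasurable (hφ0.mul hX).aestronglyMeasurable
      _ = _ := by simp [hneg]
  have hint2 : Integrable (fun ω => -(φ (τ ω) * X ω)) μ :=
    (hXint.bdd_mul (hφ0.comp hτ.measurable).aestronglyMeasurable
      (Eventually.of_forall fun ω => hφb (τ ω))).neg
  have h3 : ∫ ω, φ ω * X ω ∂μ + ∫ ω, -(φ (τ ω) * X ω) ∂μ ≤ ∫ ω, E.indicator (fun _ => 2) ω ∂μ := by
    rw [← integral_add (f := fun ω => φ ω * X ω) hφX hint2]
    refine integral_mono (hφX.add hint2) ((integrable_const _).indicator hEm) fun ω => ?_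
    by_cases h : ω ∈ E
    · rw [Set.indicator_of_mem h]
      have b1 := abs_le.1 (hbdd ω)
      simp only [φ]
      split_ifs <;> linarith
    · rw [Set.indicator_of_notMem h]
      have : φ (τ ω) = φ ω := if_congr (hE A hA ω h).symm rfl rfl
      simp [this]
  rw [integral_indicator_const _ hEm, smul_eq_mul] at h3
  linarith

/-- If the partial sums of `(a - b) / 2` and of `a * b` converge as soon as they are bounded below,
then the partial sums of the sign sequence `a` cannot eventually exceed those of `b`. -/
lemma not_eventually_sum_lt_sum {a b : ℕ → ℤ} (ha : ∀ n, |a n| = 1) (hb : ∀ n, |b n| = 1)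
    (hsub : BddBelow (Set.range fun n => ∑ i ∈ Finset.range n, ((a i : ℝ) - b i) / 2) →
      ∃ c, Tendsto (fun n => ∑ i ∈ Finset.range n, ((a i : ℝ) - b i) / 2) atTop (nhds c))
    (hmul : BddBelow (Set.range fun n => ∑ i ∈ Finset.range n, (a i : ℝ) * b i) →
      ∃ c, Tendsto (fun n => ∑ i ∈ Finset.range n, (a i : ℝ) * b i) atTop (nhds c)) :
    ¬ ∀ᶠ n in atTop, ∑ i ∈ Finset.range n, b i < ∑ i ∈ Finset.range n, a i := by
  intro hlt
  have hinc {f : ℕ → ℝ} {c : ℝ}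
      (h : Tendsto (fun n => ∑ i ∈ Finset.range n, f i) atTop (nhds c)) :
      Tendsto f atTop (nhds 0) := by
    simpa [Finset.sum_range_succ] using (h.comp (tendsto_add_atTop_nat 1)).sub h
  have hbelow : BddBelow (Set.range fun n => ∑ i ∈ Finset.range n, ((a i : ℝ) - b i) / 2) := by
    refine IsBoundedUnder.bddBelow_range ⟨0, ?_⟩
    rw [eventually_map]
    filter_upwards [hlt] with n hn
    rw [← Finset.sum_div, Finset.sum_sub_distrib]
    have : (∑ i ∈ Finset.range n, (b i : ℝ)) < ∑ i ∈ Finset.range n, (a i : ℝ) := mod_cast hn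
    change 0 ≤ _ / _
    linarith
  obtain ⟨c, hc⟩ := hsub hbelow
  have heq : ∀ᶠ n in atTop, a n = b n := by
    filter_upwards [(hinc hc).eventually (Metric.ball_mem_nhds 0 one_pos)] with n hn
    have hn : |((a n : ℝ) - b n) / 2| < 1 := by
      rwa [← sub_zero (((a n : ℝ) - b n) / 2)]
    rcases eq_or_eq_neg_of_abs_eq (ha n) with h | h <;>
      rcases eq_or_eq_neg_of_abs_eq (hb n) with h' | h' <;>
        norm_num [h, h'] at hn <;> rw [h, h']
  have hone : ∀ᶠ n in atTop, (a n : ℝ) * b n = 1 := by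
    filter_upwards [heq] with n hn
    rcases eq_or_eq_neg_of_abs_eq (hb n) with h | h <;> simp [hn, h]
  obtain ⟨N, hN⟩ := eventually_atTop.1 hone
  have hbelow' : BddBelow (Set.range fun n => ∑ i ∈ Finset.range n, (a i : ℝ) * b i) := by
    refine IsBoundedUnder.bddBelow_range ⟨∑ i ∈ Finset.range N, (a i : ℝ) * b i, ?_⟩
    rw [eventually_map]
    filter_upwards [eventually_ge_atTop N] with n hn
    refine Finset.sum_le_sum_of_subset_of_nonneg (Finset.range_mono hn) fun i _ hi => ?_
    rw [hN i (by simpa using hi)]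
    exact zero_le_one
  obtain ⟨c', hc'⟩ := hmul hbelow'
  exact zero_ne_one (tendsto_nhds_unique (hinc hc') (tendsto_const_nhds.congr'
    (hone.mono fun n hn => hn.symm)))

/-- Two sign sequences whose partial sums eventually differ have eventually ordered partial
sums. -/
lemma eventually_sum_lt_sum_or_of_eventually_ne {a b : ℕ → ℤ} (ha : ∀ n, |a n| = 1)
    (hb : ∀ n, |b n| = 1)
    (hne : ∀ᶠ n in atTop, ∑ i ∈ Finset.range n, a i ≠ ∑ i ∈ Finset.range n, b i) :
    (∀ᶠ n in atTop, ∑ i ∈ Finset.range n, b i < ∑ i ∈ Finset.range n, a i) ∨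
      ∀ᶠ n in atTop, ∑ i ∈ Finset.range n, a i < ∑ i ∈ Finset.range n, b i := by
  have hsign (n) : (a n = 1 ∨ a n = -1) ∧ (b n = 1 ∨ b n = -1) :=
    ⟨eq_or_eq_neg_of_abs_eq (ha n), eq_or_eq_neg_of_abs_eq (hb n)⟩
  have hpar (n : ℕ) : 2 ∣ ∑ i ∈ Finset.range n, a i - ∑ i ∈ Finset.range n, b i := by
    rw [← Finset.sum_sub_distrib]
    exact Finset.dvd_sum fun i _ => by have := hsign i; omega
  obtain ⟨N, hN⟩ := eventually_atTop.1 hne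
  rcases lt_or_gt_of_ne (hN N le_rfl) with h | h
  · right
    filter_upwards [eventually_ge_atTop N] with n hn
    induction n, hn using Nat.le_induction with
    | base => exact h
    | succ n hn ih =>
      have h1 := hN (n + 1) (by omega)
      have h2 := hpar n
      have h3 := hsign n
      rw [Finset.sum_range_succ, Finset.sum_range_succ] at h1 ⊢
      omega
  · left
    filter_upwards [eventually_ge_atTop N] with n hn
    induction n, hn using Nat.le_induction with
    | base => exact h
    | succ n hn ih =>
      have h1 := hN (n + 1) (by omega)
      have h2 := hpar n
      have h3 := hsign n
      rw [Finset.sum_range_succ, Finset.sum_range_succ] at h1 ⊢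
      omega

/-- The first `n` pairs of signs `(T (q_j x), T (q_j y))`, extended by zero. -/
noncomputable def signHistory (q : ℕ → ℕ) (n : ℕ) (z : UnitAddCircle × UnitAddCircle) (j : ℕ) :
    ℤ × ℤ :=
  if j < n then (haarT (q j • z.1), haarT (q j • z.2)) else 0

lemma measurable_signPair (k : ℕ) :
    Measurable fun z : UnitAddCircle × UnitAddCircle => (haarT (k • z.1), haarT (k • z.2)) :=
  (measurable_haarT.comp ((continuous_nsmul k).measurable.comp measurable_fst)).prodMk
    (measurable_haarT.comp ((continuous_nsmul k).measurable.comp measurable_snd))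

lemma measurable_signHistory (q : ℕ → ℕ) (n : ℕ) : Measurable (signHistory q n) := by
  refine measurable_pi_iff.2 fun j => ?_
  unfold signHistory
  split_ifs
  · exact measurable_signPair (q j)
  · exact measurable_const

/-- The filtration generated by the sign histories. -/
noncomputable def signFiltration (q : ℕ → ℕ) :
    Filtration ℕ (inferInstance : MeasurableSpace (UnitAddCircle × UnitAddCircle)) where
  seq n := MeasurableSpace.comap (signHistory q n) inferInstance
  mono' m n hmn := by
    have h : signHistory q m =
        (fun (f : ℕ → ℤ × ℤ) j => if j < m then f j else 0) ∘ signHistory q n := by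
      ext z j : 2
      simp only [signHistory, Function.comp_apply]
      split_ifs <;> first | rfl | omega
    have hmeas : Measurable (fun (f : ℕ → ℤ × ℤ) j => if j < m then f j else 0) := by
      refine measurable_pi_iff.2 fun j => ?_
      split_ifs
      · exact measurable_pi_apply j
      · exact measurable_const
    change MeasurableSpace.comap _ _ ≤ MeasurableSpace.comap _ _
    rw [h, ← MeasurableSpace.comap_comp]
    exact MeasurableSpace.comap_mono hmeas.comap_le
  le' n := (measurable_signHistory q n).comap_le

/-- A function of the `n`-th pair of signs which is odd in the first or in both variables has small
conditional expectation given the first `n` pairs. -/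
lemma integral_abs_condExp_signFiltration_le {q : ℕ → ℕ} (hq : ∀ n, 0 < q n) {g : ℤ × ℤ → ℝ}
    (hg : ∀ a b, |a| = 1 → |b| = 1 → |g (a, b)| ≤ 1)
    (hodd : (∀ a b, g (-a, -b) = -g (a, b)) ∨ ∀ a b, g (-a, b) = -g (a, b)) (n : ℕ) :
    ∫ z, |((volume.prod volume)[fun z => g (haarT (q n • z.1), haarT (q n • z.2)) |
        signFiltration q n]) z| ∂(volume.prod volume) ≤
      2 * ∑ j ∈ Finset.range n, (q j : ℝ) / q n := by
  have hqn : (0 : ℝ) < q n := mod_cast hq n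
  set s : ℝ := 1 / (2 * q n) with hs
  have hs0 : 0 ≤ s := by positivity
  have hhalf (u : UnitAddCircle) : haarT (q n • (u + (s : UnitAddCircle))) = -haarT (q n • u) := by
    rw [smul_add, ← AddCircle.coe_nsmul, nsmul_eq_mul, hs,
      show (q n : ℝ) * (1 / (2 * q n)) = 1 / 2 by field_simp, haarT_add_half]
  obtain ⟨r, hr0, hrs, hneg⟩ : ∃ r : ℝ, 0 ≤ r ∧ r ≤ s ∧ ∀ x y : UnitAddCircle,
      g (haarT (q n • (x + (s : UnitAddCircle))), haarT (q n • (y + (r : UnitAddCircle)))) =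
        -g (haarT (q n • x), haarT (q n • y)) := by
    rcases hodd with h | h
    · exact ⟨s, hs0, le_rfl, fun x y => by rw [hhalf, hhalf, h]⟩
    · exact ⟨0, le_rfl, hs0, fun x y => by
        rw [hhalf, AddCircle.coe_zero, add_zero, h]⟩
  set B : ℕ → ℝ → Set UnitAddCircle := fun j t =>
    {u | haarT (q j • u) ≠ haarT (q j • (u + (t : UnitAddCircle)))} with hB
  have hBm (j t) : MeasurableSet (B j t) :=
    (measurableSet_eq_fun (measurable_haarT.comp (continuous_nsmul (q j)).measurable)
      (measurable_haarT.comp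
        ((continuous_nsmul (q j)).measurable.comp (measurable_id.add_const _)))).compl
  have hBv (j) (t) (ht0 : 0 ≤ t) (hts : t ≤ s) :
      (volume : Measure UnitAddCircle).real (B j t) ≤ (q j : ℝ) / q n := by
    refine ENNReal.toReal_le_of_le_ofReal (by positivity)
      ((volume_haarT_nsmul_ne_add_le (hq j) ht0).trans (ENNReal.ofReal_le_ofReal ?_))
    calc 2 * (q j * t) ≤ 2 * (q j * s) := by gcongr
      _ = _ := by rw [hs]; field_simp
  set E : Set (UnitAddCircle × UnitAddCircle) :=
    ⋃ j ∈ Finset.range n, (Prod.fst ⁻¹' B j s ∪ Prod.snd ⁻¹' B j r) with hE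
  have hEm : MeasurableSet E := Finset.measurableSet_biUnion _ fun j _ =>
    (measurable_fst (hBm j s)).union (measurable_snd (hBm j r))
  refine (integral_abs_condExp_le_of_comp_eq_neg ((signFiltration q).le n)
    ((measurable_of_countable g).comp (measurable_signPair (q n)))
    (fun z => hg _ _ (abs_haarT _) (abs_haarT _))
    (τ := Prod.map (· + (s : UnitAddCircle)) (· + (r : UnitAddCircle)))
    ((measurePreserving_add_right volume _).prod (measurePreserving_add_right volume _))
    (fun z => hneg z.1 z.2) hEm ?_).trans ?_
  · rintro _ ⟨A, hA, rfl⟩ z hz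
    simp only [hE, hB, Set.mem_iUnion, Set.mem_union, Set.mem_preimage, Set.mem_ofPred_eq,
      Finset.mem_range, not_exists, not_or, not_not] at hz
    rw [Set.mem_preimage, Set.mem_preimage]
    have : signHistory q n (Prod.map (· + (s : UnitAddCircle)) (· + (r : UnitAddCircle)) z) =
        signHistory q n z := by
      ext j : 1
      simp only [signHistory, Prod.map_fst, Prod.map_snd]
      split_ifs with hj
      · rw [← (hz j hj).1, ← (hz j hj).2]
      · rfl
    rw [this]
  · rw [Finset.mul_sum]
    refine (measureReal_biUnion_finset_le _ _).trans (Finset.sum_le_sum fun j _ => ?_)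
    have h1 := (measurePreserving_fst (μ := (volume : Measure UnitAddCircle))
      (ν := (volume : Measure UnitAddCircle))).measureReal_preimage (hBm j s).nullMeasurableSet
    have h2 := (measurePreserving_snd (μ := (volume : Measure UnitAddCircle))
      (ν := (volume : Measure UnitAddCircle))).measureReal_preimage (hBm j r).nullMeasurableSet
    refine (measureReal_union_le _ _).trans ?_
    rw [h1, h2]
    linarith [hBv j s hs0 le_rfl, hBv j r hr0 hrs]

/-- Almost surely, the partial sums of an odd function of the sign pairs converge if they are
bounded below. -/
lemma ae_tendsto_sum_signPair_of_bddBelow {q : ℕ → ℕ} (hq : ∀ n, 0 < q n)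
    (hsum : Summable fun n : ℕ => (q n : ℝ) / (q (n + 1) : ℝ)) {g : ℤ × ℤ → ℝ}
    (hg : ∀ a b, |a| = 1 → |b| = 1 → |g (a, b)| ≤ 1)
    (hodd : (∀ a b, g (-a, -b) = -g (a, b)) ∨ ∀ a b, g (-a, b) = -g (a, b)) :
    ∀ᵐ z ∂((volume : Measure UnitAddCircle).prod (volume : Measure UnitAddCircle)),
      BddBelow (Set.range fun n =>
        ∑ i ∈ Finset.range n, g (haarT (q i • z.1), haarT (q i • z.2))) →
      ∃ c, Tendsto (fun n => ∑ i ∈ Finset.range n, g (haarT (q i • z.1), haarT (q i • z.2)))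
        atTop (nhds c) := by
  refine ae_tendsto_sum_of_bddBelow (ℱ := signFiltration q)
    (X := fun n z => g (haarT (q n • z.1), haarT (q n • z.2))) (fun n => ?_)
    (fun n z => hg _ _ (abs_haarT _) (abs_haarT _)) ?_
  · refine Measurable.stronglyMeasurable ?_
    have h : (fun z : UnitAddCircle × UnitAddCircle => g (haarT (q n • z.1), haarT (q n • z.2))) =
        (fun f : ℕ → ℤ × ℤ => g (f n)) ∘ signHistory q (n + 1) := by
      ext z
      simp [signHistory]
    rw [h]
    exact ((measurable_of_countable g).comp (measurable_pi_apply n)).comp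
      (comap_measurable (signHistory q (n + 1)))
  · exact Summable.of_nonneg_of_le (fun n => integral_nonneg fun z => abs_nonneg _)
      (fun n => integral_abs_condExp_signFiltration_le hq hg hodd n)
      ((summable_sum_div (q := fun n => (q n : ℝ)) (fun n => mod_cast hq n) hsum).mul_left 2)

/-- if `(q_n)` is a sequence of positive integers with
`Σ_{n≥1} q_n/q_{n+1} < ∞`, then for `(λ × λ)`-almost every `(x, y) ∈ 𝕋 × 𝕋` there are
infinitely many `n` with `m_n(x) = m_n(y)` (the level-crossing property). -/
theorem statement11 (q : ℕ → ℕ) (hq : ∀ n, 0 < q n)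
    (hsum : Summable (fun n : ℕ => (q n : ℝ) / (q (n + 1) : ℝ))) :
    ∀ᵐ z ∂((volume : Measure UnitAddCircle).prod (volume : Measure UnitAddCircle)),
      ∃ᶠ n in Filter.atTop, mSum q n z.1 = mSum q n z.2 := by
  have hbd (a b : ℤ) (ha : |a| = 1) (hb : |b| = 1) : |((a : ℝ) - b) / 2| ≤ 1 := by
    rcases eq_or_eq_neg_of_abs_eq ha with rfl | rfl <;>
      rcases eq_or_eq_neg_of_abs_eq hb with rfl | rfl <;> norm_num
  have hxy := ae_tendsto_sum_signPair_of_bddBelow hq hsum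
    (g := fun p => ((p.1 : ℝ) - p.2) / 2) hbd (Or.inl fun a b => by push_cast; ring)
  have hyx := ae_tendsto_sum_signPair_of_bddBelow hq hsum
    (g := fun p => ((p.2 : ℝ) - p.1) / 2) (fun a b ha hb => hbd b a hb ha)
    (Or.inl fun a b => by push_cast; ring)
  have hmul := ae_tendsto_sum_signPair_of_bddBelow hq hsum
    (g := fun p => (p.1 : ℝ) * p.2)
    (fun a b ha hb => by
      rw [abs_mul, ← Int.cast_abs, ← Int.cast_abs, ha, hb]; norm_num)
    (Or.inr fun a b => by push_cast; ring)
  filter_upwards [hxy, hyx, hmul] with z h1 h2 h3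
  have hx (n) : |haarT (q n • z.1)| = 1 := abs_haarT _
  have hy (n) : |haarT (q n • z.2)| = 1 := abs_haarT _
  rw [Filter.Frequently]
  intro hne
  rcases eventually_sum_lt_sum_or_of_eventually_ne hx hy hne with h | h
  · exact not_eventually_sum_lt_sum hx hy h1 h3 h
  · refine not_eventually_sum_lt_sum hy hx h2 ?_ h
    simpa only [mul_comm] using h3
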